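/- arXiv:math/0512042 — 4 statements merged into one kernel-verified Lean document; each statement's English description precedes it below -/
import Mathlib

section
/- If G is a tree, then for every n ≥ 1 the graph Ĝₙ, which has the same vertex set as G and in which two distinct vertices v, w are adjacent if and only if d(v,w) ≤ n, is chordal. -/
/-- A cycle (closed walk) `w` in `G` has a chord if two of its vertices are adjacent in `G`
but the corresponding edge is not an edge of the cycle. -/
def SimpleGraph.Walk.HasChord {V : Type*} {G : SimpleGraph V} {v : V}
    (w : G.Walk v v) : Prop :=
  ∃ x y : V, x ∈ w.support ∧ y ∈ w.support ∧ G.Adj x y ∧ s(x, y) ∉ w.edges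

/-- A simple graph is chordal if every cycle of length at least 4 has a chord. -/
def SimpleGraph.IsChordalGraph {V : Type*} (G : SimpleGraph V) : Prop :=
  ∀ (v : V) (w : G.Walk v v), w.IsCycle → 4 ≤ w.length → w.HasChord

/-- `Ĝₙ`: the graph on the same vertex set as `G` in which two distinct vertices are
adjacent iff their distance in `G` is at most `n`. -/
def SimpleGraph.distGraph {V : Type*} (G : SimpleGraph V) (n : ℕ) : SimpleGraph V where
  Adj v w := v ≠ w ∧ G.dist v w ≤ n
  symm := by
    constructor
    rintro v w ⟨h1, h2⟩
    exact ⟨h1.symm, by rwa [SimpleGraph.dist_comm]⟩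
  loopless := by constructor; rintro v ⟨h, -⟩; exact h rfl

open SimpleGraph in
/-- A vertex on a geodesic splits the distance. -/
lemma dist_split_of_mem_geodesic {V : Type*} {G : SimpleGraph V} {u v x : V}
    (p : G.Walk u v) (hp : p.length = G.dist u v) (hx : x ∈ p.support) :
    G.dist u x + G.dist x v ≤ G.dist u v := by
  obtain ⟨q, r, rfl⟩ := Walk.mem_support_iff_exists_append.mp hx
  rw [Walk.length_append] at hp
  have h1 := dist_le q
  have h2 := dist_le r
  omega

open SimpleGraph in
/-- If the tree edge `s r` separates `v` from `a`, the geodesic from `v` to `a` uses it. -/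
lemma dist_eq_across_edge {V : Type*} {G : SimpleGraph V} (hG : G.IsTree) {v a r s : V}
    (h : G.Adj s r) (hv : G.dist v r = G.dist v s + 1) (ha : G.dist s a = G.dist r a + 1) :
    G.dist v a = G.dist v r + G.dist r a := by
  have hc := hG.connected
  obtain ⟨p, hp, hpl⟩ := hc.exists_path_of_dist v s
  obtain ⟨q, hq, hql⟩ := hc.exists_path_of_dist r a
  obtain ⟨t, ht, htl⟩ := hc.exists_path_of_dist v a
  have hpath : (p.append (Walk.cons h q)).IsPath := by
    rw [Walk.isPath_def, Walk.support_append, Walk.support_cons, List.tail_cons,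
      List.nodup_append']
    refine ⟨hp.support_nodup, hq.support_nodup, ?_⟩
    intro x hx hx'
    have h1 := dist_split_of_mem_geodesic p hpl hx
    have h2 := dist_split_of_mem_geodesic q hql hx'
    have h3 := hc.dist_triangle (u := v) (v := x) (w := r)
    have h4 := hc.dist_triangle (u := s) (v := x) (w := a)
    have h5 := G.dist_comm (u := x) (v := r)
    have h6 := G.dist_comm (u := x) (v := s)
    omega
  have heq : t = p.append (Walk.cons h q) := (hG.existsUnique_path v a).unique ht hpath
  have := congrArg Walk.length heq
  rw [Walk.length_append, Walk.length_cons] at this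
  omega

open SimpleGraph in
/-- The four-point condition in a tree. -/
lemma tree_four_point {V : Type*} {G : SimpleGraph V} (hG : G.IsTree) (v a b : V) :
    ∀ (k : ℕ) (r : V), G.dist r v = k →
      G.dist r v + G.dist a b ≤ G.dist r a + G.dist v b ∨
      G.dist r v + G.dist a b ≤ G.dist r b + G.dist v a := by
  have hc := hG.connected
  intro k
  induction k with
  | zero =>
    intro r hr
    obtain rfl := hc.dist_eq_zero_iff.mp hr
    left
    have := hc.dist_triangle (u := a) (v := r) (w := b)
    rw [G.dist_comm (u := a) (v := r)] at this
    omega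
  | succ k ih =>
    intro r hr
    obtain ⟨p, hp, hpl⟩ := hc.exists_path_of_dist r v
    cases p with
    | nil => simp at hr
    | @cons _ s _ h p =>
      rw [Walk.length_cons] at hpl
      have h1 := dist_le p
      have h2 := hG.dist_eq_dist_add_one_of_adj v h
      rw [G.dist_comm (u := v) (v := r), G.dist_comm (u := v) (v := s)] at h2
      have hs : G.dist s v = k := by omega
      have ih := ih s hs
      have hvr : G.dist v r = G.dist v s + 1 := by
        rw [G.dist_comm (u := v) (v := r), G.dist_comm (u := v) (v := s)]; omega
      have tri := hc.dist_triangle (u := a) (v := r) (w := b)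
      have ca := G.dist_comm (u := a) (v := r)
      have cb := G.dist_comm (u := b) (v := r)
      have ca' := G.dist_comm (u := a) (v := s)
      have cb' := G.dist_comm (u := b) (v := s)
      have cv := G.dist_comm (u := v) (v := r)
      rcases hG.dist_eq_dist_add_one_of_adj a h with h3 | h3
      · rcases hG.dist_eq_dist_add_one_of_adj b h with h4 | h4
        · omega
        · have := dist_eq_across_edge hG h.symm hvr (a := b) (by omega)
          omega
      · have := dist_eq_across_edge hG h.symm hvr (a := a) (by omega)
        omega

/-- If `G` is a tree, then for every `n ≥ 1` the graph `Ĝₙ` is chordal. -/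
theorem distGraph_of_tree_isChordal {V : Type*} (G : SimpleGraph V) (hG : G.IsTree)
    (n : ℕ) (hn : 1 ≤ n) : (G.distGraph n).IsChordalGraph := by
  classical
  intro r w hw hlen
  obtain ⟨v, hv, hmax⟩ := w.support.toFinset.exists_max_image (fun x => G.dist r x)
    ⟨r, by simp⟩
  rw [List.mem_toFinset] at hv
  have hmax' : ∀ x ∈ w.support, G.dist r x ≤ G.dist r v :=
    fun x hx => hmax x (List.mem_toFinset.mpr hx)
  have hc : (w.rotate v hv).IsCycle := hw.rotate hv
  have hl : (w.rotate v hv).length = w.length := w.length_rotate v hv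
  have hsup : ∀ x, x ∈ (w.rotate v hv).support ↔ x ∈ w.support :=
    fun x => w.mem_support_rotate_iff v hv
  have hed : ∀ e, e ∈ (w.rotate v hv).edges ↔ e ∈ w.edges :=
    fun e => (w.rotate_edges v hv).mem_iff
  generalize w.rotate v hv = c at hc hl hsup hed
  have inj := hc.getVert_injOn
  have hend : c.getVert c.length = v := c.getVert_length
  have h0 : c.getVert 0 = v := c.getVert_zero
  have adj1 := c.adj_getVert_succ (i := 0) (by omega)
  have adj2 := c.adj_getVert_succ (i := c.length - 1) (by omega)
  rw [show c.length - 1 + 1 = c.length by omega, hend] at adj2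
  rw [h0, zero_add] at adj1
  have ha := (hsup _).mp (c.getVert_mem_support 1)
  have hb := (hsup _).mp (c.getVert_mem_support (c.length - 1))
  refine ⟨c.getVert 1, c.getVert (c.length - 1), ha, hb, ⟨?_, ?_⟩, ?_⟩
  · intro h
    have := inj (by simp; omega) (by simp; omega) h
    omega
  · have h1 : G.dist v (c.getVert 1) ≤ n := adj1.2
    have h2 : G.dist (c.getVert (c.length - 1)) v ≤ n := adj2.2
    rw [G.dist_comm] at h2
    have h3 := hmax' _ ha
    have h4 := hmax' _ hb
    have := tree_four_point hG v (c.getVert 1) (c.getVert (c.length - 1)) _ r rfl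
    omega
  · rw [← hed, SimpleGraph.Walk.mk_mem_edges_iff_exists]
    rintro ⟨i, hi, he⟩
    have key : ∀ j k, j ≤ c.length → 1 ≤ k → k < c.length → c.getVert j = c.getVert k → j = k := by
      intro j k hj hk hk' hjk
      rcases Nat.eq_zero_or_pos j with rfl | hj0
      · replace hjk := hend.trans (h0.symm.trans hjk)
        have := inj (by simp; omega) (by simp; omega) hjk
        omega
      · exact inj (by simp; omega) (by simp; omega) hjk
    rcases Sym2.eq_iff.mp he with ⟨e1, e2⟩ | ⟨e1, e2⟩
    · have := key _ _ (by omega) (by omega) (by omega) e1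
      have := key _ _ (by omega) (by omega) (by omega) e2
      omega
    · have := key _ _ (by omega) (by omega) (by omega) e1
      have := key _ _ (by omega) (by omega) (by omega) e2
      omega
end

section
/- Let G be a tree, n ≥ 1, and x, y vertices of G with d(x,y) = n+1. Then the set {z : max(d(z,x), d(z,y)) ≤ n} is a clique in Ĝₙ; equivalently, any two distinct vertices z, w with max(d(z,x), d(z,y)) ≤ n and max(d(w,x), d(w,y)) ≤ n satisfy d(z,w) ≤ n. -/
theorem tree_path_length {V : Type*} {G : SimpleGraph V} (hG : G.IsTree) {u v : V}
    (p : G.Walk u v) (hp : p.IsPath) : G.dist u v = p.length := by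
  obtain ⟨q, hq, hl⟩ := hG.1.exists_path_of_dist u v
  rw [← hl, (hG.existsUnique_path u v).unique hq hp]

theorem tree_gate_aux {V : Type*} {G : SimpleGraph V} (hG : G.IsTree) {x m w : V}
    (p : G.Walk m w) (hp : p.IsPath) (hmin : ∀ v ∈ p.support, G.dist x m ≤ G.dist x v) :
    G.dist x w = G.dist x m + p.length := by
  classical
  obtain ⟨r, hr, hl⟩ := hG.1.exists_path_of_dist x m
  have hpath : (r.append p).IsPath := by
    rw [SimpleGraph.Walk.isPath_def, SimpleGraph.Walk.support_append, List.nodup_append']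
    refine ⟨hr.support_nodup, hp.support_nodup.tail, ?_⟩
    intro v hv hv'
    have h1 := hmin v (List.mem_of_mem_tail hv')
    have h2 := SimpleGraph.dist_le (r.takeUntil v hv)
    have hne : v ≠ m := by
      rintro rfl
      have h3 := hp.support_nodup
      rw [← SimpleGraph.Walk.cons_tail_support] at h3
      exact (List.nodup_cons.mp h3).1 hv'
    have h4 := SimpleGraph.Walk.length_takeUntil_lt_length hv hne
    omega
  rw [tree_path_length hG _ hpath, SimpleGraph.Walk.length_append, hl]

theorem tree_gate {V : Type*} {G : SimpleGraph V} (hG : G.IsTree) (x : V) {z w : V}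
    (p : G.Walk z w) (hp : p.IsPath) :
    ∃ i ≤ p.length, G.dist x z = G.dist x (p.getVert i) + i ∧
      G.dist x w = G.dist x (p.getVert i) + (p.length - i) := by
  obtain ⟨i, hi, hmin⟩ := Finset.exists_min_image (Finset.range (p.length + 1))
    (fun i => G.dist x (p.getVert i)) ⟨0, by simp⟩
  have hi' : i ≤ p.length := by simpa [Nat.lt_succ_iff] using hi
  have hmin' : ∀ v ∈ p.support, G.dist x (p.getVert i) ≤ G.dist x v := by
    intro v hv
    obtain ⟨j, rfl, hj⟩ := SimpleGraph.Walk.mem_support_iff_exists_getVert.mp hv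
    exact hmin j (by simpa [Nat.lt_succ_iff] using hj)
  refine ⟨i, hi', ?_, ?_⟩
  · have := tree_gate_aux hG (x := x) (p.take i).reverse (hp.take i).reverse (by
      intro v hv
      refine hmin' v ?_
      rw [SimpleGraph.Walk.support_reverse, List.mem_reverse, SimpleGraph.Walk.support_take] at hv
      exact List.mem_of_mem_take hv)
    simpa [SimpleGraph.Walk.take_length, hi'] using this
  · have := tree_gate_aux hG (x := x) (p.drop i) (hp.drop i) (by
      intro v hv
      refine hmin' v ?_
      rw [SimpleGraph.Walk.drop_support_eq_support_drop_min] at hv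
      exact List.mem_of_mem_drop hv)
    simpa [SimpleGraph.Walk.drop_length] using this

theorem walk_dist_getVert {V : Type*} {G : SimpleGraph V} (hG : G.Connected) {z w : V}
    (p : G.Walk z w) (i k : ℕ) : G.dist (p.getVert i) (p.getVert (i + k)) ≤ k := by
  have h := SimpleGraph.dist_le ((p.drop i).take k)
  rw [SimpleGraph.Walk.take_length, SimpleGraph.Walk.drop_getVert] at h
  exact h.trans (min_le_left _ _)

/-- Let `G` be a tree, `n ≥ 1`, and `x, y` vertices with `d(x,y) = n+1`.
Then `{z : max (d(z,x), d(z,y)) ≤ n}` is a clique in `Ĝₙ`. -/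
theorem tree_distGraph_clique {V : Type*} (G : SimpleGraph V) (hG : G.IsTree)
    (n : ℕ) (hn : 1 ≤ n) (x y : V) (hxy : G.dist x y = n + 1) :
    (G.distGraph n).IsClique {z : V | max (G.dist z x) (G.dist z y) ≤ n} := by
  intro z hz w hw hne
  refine ⟨hne, ?_⟩
  simp only [Set.mem_setOf_eq, max_le_iff] at hz hw
  obtain ⟨hzx, hzy⟩ := hz
  obtain ⟨hwx, hwy⟩ := hw
  rw [SimpleGraph.dist_comm] at hzx hzy hwx hwy
  obtain ⟨p, hp, hl⟩ := hG.1.exists_path_of_dist z w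
  obtain ⟨i, hi, h1, h2⟩ := tree_gate hG x p hp
  obtain ⟨j, hj, h3, h4⟩ := tree_gate hG y p hp
  have t1 := hG.1.dist_triangle (u := x) (v := p.getVert i) (w := y)
  have t2 := hG.1.dist_triangle (u := p.getVert i) (v := p.getVert j) (w := y)
  rw [SimpleGraph.dist_comm (u := p.getVert j) (v := y)] at t2
  rcases le_total i j with hij | hij
  · obtain ⟨k, rfl⟩ := Nat.exists_eq_add_of_le hij
    have t3 := walk_dist_getVert hG.1 p i k
    omega
  · obtain ⟨k, rfl⟩ := Nat.exists_eq_add_of_le hij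
    have t3 := walk_dist_getVert hG.1 p j k
    rw [SimpleGraph.dist_comm] at t3
    omega
end

section
/- Fix a lexicographic order ≼ on the free group F = Fₘ, and let ν, ν⁺ ∈ F̂ with ν⁺ the immediate successor of ν (ν ≺ ν⁺ and no class lies strictly between them). If C ⊆ F is a clique in Γ_{ν⁺} which is not a clique in Γ_ν, then C contains exactly one unordered pair {s,t} of distinct elements with the class of s⁻¹t equal to ν⁺ (i.e., a single edge of Γ_{ν⁺} which is not an edge of Γ_ν). -/
namespace FreeGroupLex

variable {m : ℕ}

/-- The length of the longest common prefix of two lists. -/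
def commonPrefixLen {α : Type*} [DecidableEq α] : List α → List α → ℕ
  | a :: as, b :: bs => if a = b then commonPrefixLen as bs + 1 else 0
  | _, _ => 0

/-- A strict total order `lt` on the free group `Fₘ` is *lexicographic* if:
(1) shorter (reduced) words come first; (2) words of equal length are compared by the
first letter (an element of `A ∪ A⁻¹`, i.e. a one-letter word) at which their reduced
words differ. -/
def IsLexOrder (lt : FreeGroup (Fin m) → FreeGroup (Fin m) → Prop) : Prop :=
  IsStrictTotalOrder (FreeGroup (Fin m)) lt ∧
  (∀ s t : FreeGroup (Fin m), FreeGroup.norm s < FreeGroup.norm t → lt s t) ∧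
  (∀ s t : FreeGroup (Fin m), FreeGroup.norm s = FreeGroup.norm t → s ≠ t →
    ∀ a b : Fin m × Bool,
      s.toWord[commonPrefixLen s.toWord t.toWord]? = some a →
      t.toWord[commonPrefixLen s.toWord t.toWord]? = some b →
      (lt s t ↔ lt (FreeGroup.mk [a]) (FreeGroup.mk [b])))

/-- The induced order on `F̂ = F/{s ∼ s⁻¹}`: the class of `x` is `≼` the class of `y`
iff `min {x, x⁻¹} ≼ min {y, y⁻¹}`, written without choice via
`min {x,x⁻¹} ≼ min {y,y⁻¹} ↔ (x ≼ y ∨ x⁻¹ ≼ y) ∧ (x ≼ y⁻¹ ∨ x⁻¹ ≼ y⁻¹)`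
(where `u ≼ v` means `lt u v ∨ u = v`). -/
def hatLe (lt : FreeGroup (Fin m) → FreeGroup (Fin m) → Prop)
    (x y : FreeGroup (Fin m)) : Prop :=
  ((lt x y ∨ x = y) ∨ (lt x⁻¹ y ∨ x⁻¹ = y)) ∧
  ((lt x y⁻¹ ∨ x = y⁻¹) ∨ (lt x⁻¹ y⁻¹ ∨ x⁻¹ = y⁻¹))

/-- Strict version of `hatLe`: the class of `x` is strictly before the class of `y`. -/
def hatLt (lt : FreeGroup (Fin m) → FreeGroup (Fin m) → Prop)
    (x y : FreeGroup (Fin m)) : Prop :=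
  hatLe lt x y ∧ ¬ hatLe lt y x

/-- Equality of classes in `F̂`, expressed via `hatLe`. -/
def hatEq (lt : FreeGroup (Fin m) → FreeGroup (Fin m) → Prop)
    (x y : FreeGroup (Fin m)) : Prop :=
  hatLe lt x y ∧ hatLe lt y x

/-- The graph `Γ_ν` on the vertex set `F`: distinct `s, t` are adjacent iff the class of
`s⁻¹t` is `≼ ν` (the class of `ν`). -/
def Gamma (lt : FreeGroup (Fin m) → FreeGroup (Fin m) → Prop)
    (ν : FreeGroup (Fin m)) : SimpleGraph (FreeGroup (Fin m)) where
  Adj s t := s ≠ t ∧ hatLe lt (s⁻¹ * t) ν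
  symm := by
    constructor
    rintro s t ⟨h1, h2⟩
    refine ⟨h1.symm, ?_⟩
    have e : t⁻¹ * s = (s⁻¹ * t)⁻¹ := by group
    rw [e]
    unfold hatLe at h2 ⊢
    rw [inv_inv]
    tauto
  loopless := by constructor; rintro s ⟨h, -⟩; exact h rfl

section helpers

open FreeGroup

variable {α : Type*} [DecidableEq α]

theorem toWord_mk_red {l : List (α × Bool)} (h : IsReduced l) : (mk l).toWord = l := by
  rw [toWord_mk, h.reduce_eq]

theorem word_of_norm {p q : FreeGroup α} (h : norm (p * q) = norm p + norm q) :
    (p * q).toWord = p.toWord ++ q.toWord := by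
  apply (toWord_mul_sublist p q).eq_of_length
  simpa [FreeGroup.norm] using h

theorem norm_of_red {p q : FreeGroup α} (h : IsReduced (p.toWord ++ q.toWord)) :
    norm (p * q) = norm p + norm q := by
  unfold FreeGroup.norm
  rw [toWord_mul, h.reduce_eq, List.length_append]

theorem red_of_norm {p q : FreeGroup α} (h : norm (p * q) = norm p + norm q) :
    IsReduced (p.toWord ++ q.toWord) := by
  rw [← word_of_norm h]; exact isReduced_toWord

theorem prefix_split {a b a' b' : FreeGroup α} (h : a * b = a' * b')
    (h1 : norm (a * b) = norm a + norm b) (h2 : norm (a' * b') = norm a' + norm b')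
    (hle : norm a ≤ norm a') :
    ∃ r, a' = a * r ∧ b = r * b' ∧ norm a' = norm a + norm r ∧ norm b = norm r + norm b' := by
  have e : a.toWord ++ b.toWord = a'.toWord ++ b'.toWord := by
    rw [← word_of_norm h1, ← word_of_norm h2, h]
  have key : ∃ l, a'.toWord = a.toWord ++ l := by
    have : a.toWord <+: a'.toWord :=
      List.prefix_of_prefix_length_le ⟨b.toWord, e⟩ ⟨b'.toWord, rfl⟩ hle
    obtain ⟨l, hl⟩ := this
    exact ⟨l, hl.symm⟩
  obtain ⟨l, hl⟩ := key
  have hlr : IsReduced l := by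
    apply (isReduced_toWord (x := a')).infix
    exact ⟨a.toWord, [], by simp [hl]⟩
  have ha' : a' = a * mk l := by
    rw [← mk_toWord (x := a'), hl, ← mul_mk, mk_toWord]
  have hb : b = mk l * b' := by
    rw [ha', mul_assoc] at h
    exact mul_left_cancel h
  have hn : norm (mk l) = l.length := by rw [FreeGroup.norm, toWord_mk_red hlr]
  have hna : norm a' = norm a + norm (mk l) := by
    rw [hn]; simp [FreeGroup.norm, hl]
  refine ⟨mk l, ha', hb, hna, ?_⟩
  rw [h] at h1
  omega

theorem prefix_eq {a b a' b' : FreeGroup α} (h : a * b = a' * b')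
    (h1 : norm (a * b) = norm a + norm b) (h2 : norm (a' * b') = norm a' + norm b')
    (hle : norm a = norm a') : a = a' := by
  obtain ⟨r, h3, -, h4, -⟩ := prefix_split h h1 h2 hle.le
  have : r = 1 := norm_eq_zero.1 (by omega)
  simp [h3, this]

theorem overlap {p q r : FreeGroup α} (h1 : norm (p * q) = norm p + norm q)
    (h2 : norm (q * r) = norm q + norm r) (hq : q ≠ 1) :
    norm (p * q * r) = norm p + norm q + norm r := by
  rw [norm_of_red, h1]
  rw [word_of_norm h1]
  exact IsReduced.append_overlap (red_of_norm h1) (red_of_norm h2) (by simpa using hq)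

theorem cancel_decomp (n : ℕ) : ∀ a b : FreeGroup α, norm a = n → ∃ a1 c b1 : FreeGroup α,
    a = a1 * c ∧ b = c⁻¹ * b1 ∧ norm a = norm a1 + norm c ∧ norm b = norm c + norm b1 ∧
    norm (a * b) = norm a1 + norm b1 := by
  induction n with
  | zero =>
    intro a b h
    have : a = 1 := norm_eq_zero.1 h
    subst this
    exact ⟨1, 1, b, by simp, by simp, by simp, by simp, by simp⟩
  | succ n ih =>
    intro a b h
    by_cases hr : IsReduced (a.toWord ++ b.toWord)
    · exact ⟨a, 1, b, by simp, by simp, by simp, by simp, norm_of_red hr⟩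
    · have hra := isReduced_toWord (x := a)
      have hrb := isReduced_toWord (x := b)
      unfold FreeGroup.IsReduced at hr
      rw [List.isChain_append] at hr
      have hr' : ¬ ∀ x ∈ a.toWord.getLast?, ∀ y ∈ b.toWord.head?, x.1 = y.1 → x.2 = y.2 := by
        intro hh; exact hr ⟨hra, hrb, hh⟩
      push Not at hr'
      obtain ⟨x, hx, y, hy, hxy1, hxy2⟩ := hr'
      have hx' := List.dropLast_append_getLast? x hx
      obtain ⟨l, hl⟩ : ∃ l, b.toWord = y :: l := by
        rcases hbw : b.toWord with _ | ⟨z, l⟩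
        · simp [hbw] at hy
        · simp [hbw] at hy; exact ⟨l, by simp [hy]⟩
      set k := a.toWord.dropLast with hk
      have hkr : IsReduced k := hra.infix ⟨[], [x], by simpa using hx'⟩
      have hlr : IsReduced l := hrb.infix ⟨[y], [], by simp [hl]⟩
      have ea : a = mk k * mk [x] := by
        rw [mul_mk, hx', mk_toWord]
      have eb : b = (mk [x])⁻¹ * mk l := by
        have : [(x.1, !x.2)] = [y] := by
          rcases x with ⟨x1, x2⟩
          rcases y with ⟨y1, y2⟩
          simp at hxy1 hxy2 ⊢
          refine ⟨hxy1, ?_⟩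
          exact (by decide : ∀ p q : Bool, ¬ p = q → p = !q) _ _ hxy2
        rw [inv_mk, mul_mk]
        simp only [invRev, List.map_cons, List.map_nil, List.reverse_cons, List.reverse_nil,
          List.nil_append]
        rw [this, ← mk_toWord (x := b), hl]; rfl
      have nk : norm (mk k) = k.length := by rw [FreeGroup.norm, toWord_mk_red hkr]
      have nl : norm (mk l) = l.length := by rw [FreeGroup.norm, toWord_mk_red hlr]
      have na : norm a = k.length + 1 := by have := congrArg List.length hx'; simp only [List.length_append, List.length_singleton] at this; exact this.symm
      have nb : norm b = l.length + 1 := by rw [FreeGroup.norm, hl]; simp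
      obtain ⟨a1, c, b1, h1, h2, h3, h4, h5⟩ := ih (mk k) (mk l) (by omega)
      have n1 : norm (mk [x]) ≤ 1 := by simpa using norm_mk_le (L₁ := [x])
      have n2 := norm_mul_le c (mk [x])
      have n3 := norm_mul_le a1 (c * mk [x])
      have e1 : a = a1 * (c * mk [x]) := by rw [ea, h1]; group
      rw [← e1] at n3
      refine ⟨a1, c * mk [x], b1, e1, ?_, ?_, ?_, ?_⟩
      · rw [eb, h2]; group
      · omega
      · omega
      · rw [← h5, ea, eb]; congr 1; group

theorem norm_sq {x : FreeGroup α} (h : norm (x * x) ≤ norm x) : x = 1 := by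
  obtain ⟨a, c, d, h1, h2, h3, h4, h5⟩ := cancel_decomp _ x x rfl
  have hc : norm c⁻¹ = norm c := norm_inv_eq
  obtain ⟨r, e1, e2, e3, e4⟩ := prefix_split (a := a) (b := c) (a' := c⁻¹) (b' := d)
    (by rw [← h1, ← h2]) (by rw [← h1, h3]) (by rw [← h2, h4, hc]) (by omega)
  have e5 : c = r⁻¹ * a⁻¹ := by rw [← inv_inv c, e1]; group
  have nr : norm r⁻¹ = norm r := norm_inv_eq
  have na : norm a⁻¹ = norm a := norm_inv_eq
  have e6 : r = r⁻¹ := by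
    apply prefix_eq (b := d) (b' := a⁻¹)
    · rw [← e2, ← e5]
    · rw [← e2, e4]
    · rw [← e5]; omega
    · omega
  have e7 : r = 1 := by
    have : r ^ 2 = 1 := by rw [pow_two]; nth_rw 1 [e6]; group
    exact (pow_eq_one_iff_left (by norm_num)).1 this
  subst e7
  rw [h1, e5]; group

theorem core_norm {x g : FreeGroup α} (hg : g ≠ 1) (h1 : norm g ≤ norm x)
    (h2 : norm (x⁻¹ * g) ≤ norm x) (h3 : norm (g * x) ≤ norm x)
    (h4 : norm (x⁻¹ * g * x) ≤ norm x) :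
    ∃ u w v v' u' : FreeGroup α, x = u * w * v ∧ x = v' * w⁻¹ * u' ∧ g = u * w * v'⁻¹ ∧
      norm u = norm u' ∧ norm v = norm v' ∧ norm x = norm u + norm w + norm v ∧
      norm (x⁻¹ * g * x) = norm x := by
  obtain ⟨bi, ci, e, p1, p2, p3, p4, p5⟩ := cancel_decomp _ x⁻¹ g rfl
  obtain ⟨k, fi, h, q1, q2, q3, q4, q5⟩ := cancel_decomp _ g x rfl
  have nx : norm x⁻¹ = norm x := norm_inv_eq
  have nci : norm ci⁻¹ = norm ci := norm_inv_eq
  have nbi : norm bi⁻¹ = norm bi := norm_inv_eq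
  have nfi : norm fi⁻¹ = norm fi := norm_inv_eq
  obtain ⟨w, r1, r2, r3, r4⟩ := prefix_split (a := k) (b := fi) (a' := ci⁻¹) (b' := e)
    (by rw [← p2, ← q1]) (by rw [← q1, q3]) (by rw [← p2, p4, nci]) (by omega)
  have nw : norm w⁻¹ = norm w := norm_inv_eq
  have ne : norm e⁻¹ = norm e := norm_inv_eq
  have x1 : x = k * w * bi⁻¹ := by
    rw [← r1, ← mul_inv_rev, ← p1, inv_inv]
  have x2 : x = e⁻¹ * w⁻¹ * h := by
    rw [← mul_inv_rev, ← r2, ← q2]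
  have g1 : g = k * w * e := by rw [← r1, ← p2]
  have z1 : x⁻¹ * g * x = bi * w⁻¹ * h := by
    nth_rw 1 [x1]
    nth_rw 1 [x2]
    rw [g1]; group
  by_cases hw : w = 1
  · exfalso
    subst hw
    simp only [FreeGroup.norm_one] at *
    have : k = e⁻¹ := by
      apply prefix_eq (b := bi⁻¹) (b' := h)
      · rw [mul_one] at x1; rw [inv_one, mul_one] at x2; rw [← x1, ← x2]
      · rw [mul_one] at x1; rw [← x1]; omega
      · rw [inv_one, mul_one] at x2; rw [← x2]; omega
      · omega
    apply hg
    rw [g1, this]; group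
  · have t1 := norm_mul_le e⁻¹ (w⁻¹ * h)
    have t2 := norm_mul_le w⁻¹ h
    rw [← mul_assoc, ← x2] at t1
    have t3 := norm_mul_le k (w * bi⁻¹)
    have t4 := norm_mul_le w bi⁻¹
    rw [← mul_assoc, ← x1] at t3
    have t5 : norm (bi * w⁻¹) = norm (w * bi⁻¹) := by
      rw [← norm_inv_eq]; congr 1; group
    have ov := overlap (p := bi) (q := w⁻¹) (r := h) (by omega) (by omega) (by simpa using hw)
    rw [← z1] at ov
    refine ⟨k, w, bi⁻¹, e⁻¹, h, x1, x2, by rw [inv_inv]; exact g1, ?_, ?_, ?_, ?_⟩ <;> omega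

theorem cpl_append {β : Type*} [DecidableEq β] (p p' : List β) (hl : p.length = p'.length)
    (hne : p ≠ p') : ∃ (i : ℕ) (a b : β), p[i]? = some a ∧ p'[i]? = some b ∧
      ∀ q r : List β, commonPrefixLen (p ++ q) (p' ++ r) = i := by
  induction p generalizing p' with
  | nil => cases p' <;> simp_all
  | cons x p ih =>
    cases p' with
    | nil => simp at hl
    | cons y p' =>
      by_cases hxy : x = y
      · subst hxy
        obtain ⟨i, a, b, h1, h2, h3⟩ := ih p' (by simpa using hl) (by simpa using hne)
        refine ⟨i + 1, a, b, by simpa using h1, by simpa using h2, ?_⟩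
        intro q r
        simp [commonPrefixLen, h3]
      · exact ⟨0, x, y, by simp, by simp, by simp [commonPrefixLen, hxy]⟩

theorem ord_lemma {lt : FreeGroup (Fin m) → FreeGroup (Fin m) → Prop} (hlt : IsLexOrder lt)
    {p p' q q' r : FreeGroup (Fin m)} (hne : p ≠ p') (hp : norm p = norm p')
    (h1 : norm (p * q) = norm p + norm q) (h2 : norm (p * q') = norm p + norm q')
    (h3 : norm (p' * r) = norm p' + norm r) (hq : norm q = norm r) (hq' : norm q' = norm r) :
    lt (p * q) (p' * r) ↔ lt (p * q') (p' * r) := by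
  obtain ⟨i, a, b, ha, hb, hi⟩ := cpl_append p.toWord p'.toWord hp
    (fun h => hne (toWord_injective h))
  have w1 := word_of_norm h1
  have w2 := word_of_norm h2
  have w3 := word_of_norm h3
  have app : ∀ {l l' : List (Fin m × Bool)} {c}, l[i]? = some c → (l ++ l')[i]? = some c := by
    intro l l' c hc
    rw [List.getElem?_append_left]
    · exact hc
    · exact (List.getElem?_eq_some_iff.1 hc).1
  rw [hlt.2.2 (p * q) (p' * r) (by omega)
      (fun h => hne (prefix_eq h h1 h3 hp)) a b
      (by rw [w1, w3, hi]; exact app ha) (by rw [w1, w3, hi]; exact app hb),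
    hlt.2.2 (p * q') (p' * r) (by omega)
      (fun h => hne (prefix_eq h h2 h3 hp)) a b
      (by rw [w2, w3, hi]; exact app ha) (by rw [w2, w3, hi]; exact app hb)]

theorem hatLe_norm {lt : FreeGroup (Fin m) → FreeGroup (Fin m) → Prop} (hlt : IsLexOrder lt)
    {x y : FreeGroup (Fin m)} (h : hatLe lt x y) : norm x ≤ norm y := by
  haveI := hlt.1
  by_contra hc
  have nx : norm x⁻¹ = norm x := norm_inv_eq
  have a1 := hlt.2.1 y x (by omega)
  have a2 := hlt.2.1 y x⁻¹ (by omega)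
  rcases h.1 with (h | h) | (h | h)
  · exact asymm_of lt h a1
  · subst h; omega
  · exact asymm_of lt h a2
  · subst h; omega

theorem core {lt : FreeGroup (Fin m) → FreeGroup (Fin m) → Prop} (hlt : IsLexOrder lt)
    {x g : FreeGroup (Fin m)} (hx : x ≠ 1) (hxx : ¬ lt x⁻¹ x) (hg : g ≠ 1)
    (h1 : hatLe lt g x) (h2 : hatLe lt (x⁻¹ * g) x) (h3 : hatLe lt (g * x) x)
    (h4 : hatLe lt (x⁻¹ * g * x) x) : False := by
  have n1 := hatLe_norm hlt h1
  have n2 := hatLe_norm hlt h2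
  have n3 := hatLe_norm hlt h3
  have n4 := hatLe_norm hlt h4
  obtain ⟨u, w, v, v', u', x1, x2, g1, nu, nv, nx, nz⟩ := core_norm hg n1 n2 n3 n4
  have z1 : x⁻¹ * g * x = v⁻¹ * (w⁻¹ * u') := by
    nth_rw 1 [x1]
    nth_rw 1 [x2]
    rw [g1]; group
  have z2 : (x⁻¹ * g * x)⁻¹ = u'⁻¹ * (w * v) := by rw [z1]; group
  have y1 : x⁻¹ = v⁻¹ * (w⁻¹ * u⁻¹) := by rw [x1]; group
  have y2 : x⁻¹ = u'⁻¹ * (w * v'⁻¹) := by rw [x2]; group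
  have nzi : norm (x⁻¹ * g * x)⁻¹ = norm (x⁻¹ * g * x) := norm_inv_eq
  have nxi : norm x⁻¹ = norm x := norm_inv_eq
  have nui : norm u⁻¹ = norm u := norm_inv_eq
  have nui' : norm u'⁻¹ = norm u' := norm_inv_eq
  have nvi : norm v⁻¹ = norm v := norm_inv_eq
  have nvi' : norm v'⁻¹ = norm v' := norm_inv_eq
  have nwi : norm w⁻¹ = norm w := norm_inv_eq
  rw [mul_assoc] at x1 x2
  have m1 := norm_mul_le u (w * v)
  have m2 := norm_mul_le w v
  have m3 := norm_mul_le v' (w⁻¹ * u')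
  have m4 := norm_mul_le w⁻¹ u'
  have m5 := norm_mul_le v⁻¹ (w⁻¹ * u⁻¹)
  have m6 := norm_mul_le w⁻¹ u⁻¹
  have m7 := norm_mul_le u'⁻¹ (w * v'⁻¹)
  have m8 := norm_mul_le w v'⁻¹
  have m9 := norm_mul_le v⁻¹ (w⁻¹ * u')
  have m10 := norm_mul_le u'⁻¹ (w * v)
  rw [← x1] at m1
  rw [← x2] at m3
  rw [← y1] at m5
  rw [← y2] at m7
  rw [← z1] at m9
  rw [← z2] at m10
  have fin1 : v⁻¹ = v' → False := by
    intro e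
    have : g = x := by rw [g1, ← e, x1]; group
    rw [this] at n3
    exact hx (norm_sq n3)
  have fin2 : u'⁻¹ = u → False := by
    intro e
    have : (x⁻¹ * g * x)⁻¹ = x := by rw [z2, e, ← x1]
    have e2 : g = x⁻¹ := by
      have e3 : g = x * (x⁻¹ * g * x)⁻¹⁻¹ * x⁻¹ := by group
      rw [this] at e3
      rw [e3]; group
    rw [e2] at n2
    exact hx (inv_eq_one.1 (norm_sq (by omega)))
  rcases h4.1 with (h | h) | (h | h)
  · by_cases e : v⁻¹ = v'
    · exact fin1 e
    · have := ord_lemma hlt (q := w⁻¹ * u') (q' := w⁻¹ * u⁻¹) (r := w⁻¹ * u') e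
        (by omega) (by rw [← z1]; omega) (by rw [← y1]; omega) (by rw [← x2]; omega) rfl (by omega)
      rw [← z1, ← y1, ← x2] at this
      exact hxx (this.1 h)
  · apply fin1
    rw [z1] at h
    nth_rw 1 [x2] at h
    exact mul_right_cancel h
  · by_cases e : u'⁻¹ = u
    · exact fin2 e
    · have := ord_lemma hlt (q := w * v) (q' := w * v'⁻¹) (r := w * v) e
        (by omega) (by rw [← z2]; omega) (by rw [← y2]; omega) (by rw [← x1]; omega) rfl (by omega)
      rw [← z2, ← y2, ← x1] at this
      exact hxx (this.1 h)
  · apply fin2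
    rw [z2] at h
    nth_rw 1 [x1] at h
    exact mul_right_cancel h

theorem hatLe_inv_left {lt : FreeGroup (Fin m) → FreeGroup (Fin m) → Prop}
    {x y : FreeGroup (Fin m)} : hatLe lt x⁻¹ y ↔ hatLe lt x y := by
  unfold hatLe; rw [inv_inv]; tauto

theorem hatLe_inv_right {lt : FreeGroup (Fin m) → FreeGroup (Fin m) → Prop}
    {x y : FreeGroup (Fin m)} : hatLe lt x y⁻¹ ↔ hatLe lt x y := by
  unfold hatLe; rw [inv_inv]; tauto

theorem hatLe_iff {lt : FreeGroup (Fin m) → FreeGroup (Fin m) → Prop} (hlt : IsLexOrder lt) :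
    ∃ f : FreeGroup (Fin m) → FreeGroup (Fin m), (∀ x, f x = x ∨ f x = x⁻¹) ∧
      (∀ x, ¬ lt (f x)⁻¹ (f x)) ∧
      (∀ x y, hatLe lt x y ↔ (lt (f x) (f y) ∨ f x = f y)) := by
  classical
  haveI := hlt.1
  have key : ∀ x, ∃ y, (y = x ∨ y = x⁻¹) ∧ ¬ lt y⁻¹ y := by
    intro x
    by_cases h : lt x⁻¹ x
    · exact ⟨x⁻¹, Or.inr rfl, by rw [inv_inv]; exact asymm_of lt h⟩
    · exact ⟨x, Or.inl rfl, h⟩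
  choose f hf1 hf2 using key
  refine ⟨f, hf1, hf2, ?_⟩
  intro x y
  have e : hatLe lt x y ↔ hatLe lt (f x) (f y) := by
    rcases hf1 x with h | h <;> rcases hf1 y with h' | h' <;> rw [h, h'] <;>
      simp [hatLe_inv_left, hatLe_inv_right]
  rw [e]
  have hx := hf2 x
  have hy := hf2 y
  generalize f x = a at *
  generalize f y = b at *
  letI := linearOrderOfSTO lt
  have l1 : ∀ s t, (lt s t ∨ s = t) ↔ s ≤ t := by
    intro s t
    rw [le_iff_lt_or_eq]; rfl
  have hx' : a ≤ a⁻¹ := not_lt.1 hx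
  have hy' : b ≤ b⁻¹ := not_lt.1 hy
  unfold hatLe
  simp only [l1]
  constructor
  · rintro ⟨h | h, -⟩
    · exact h
    · exact hx'.trans h
  · intro h
    exact ⟨Or.inl h, Or.inl (h.trans hy')⟩

end helpers

/-- Let `ν⁺` be the immediate successor of `ν` in `F̂`. If `C` is a clique
in `Γ_{ν⁺}` which is not a clique in `Γ_ν`, then `C` contains exactly one unordered pair
`{s, t}` of distinct elements whose quotient `s⁻¹t` lies in the class `ν⁺`. -/
theorem gamma_succ_clique_unique_new_edge {m : ℕ}
    (lt : FreeGroup (Fin m) → FreeGroup (Fin m) → Prop) (hlt : IsLexOrder lt)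
    (ν ν' : FreeGroup (Fin m))
    (hsucc : hatLt lt ν ν' ∧ ∀ μ : FreeGroup (Fin m), ¬ (hatLt lt ν μ ∧ hatLt lt μ ν'))
    (C : Set (FreeGroup (Fin m)))
    (hC' : (Gamma lt ν').IsClique C) (hC : ¬ (Gamma lt ν).IsClique C) :
    ∃ s t : FreeGroup (Fin m), s ∈ C ∧ t ∈ C ∧ s ≠ t ∧ hatEq lt (s⁻¹ * t) ν' ∧
      ∀ s' t' : FreeGroup (Fin m), s' ∈ C → t' ∈ C → s' ≠ t' → hatEq lt (s'⁻¹ * t') ν' →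
        (s' = s ∧ t' = t) ∨ (s' = t ∧ t' = s) := by
  classical
  haveI := hlt.1
  obtain ⟨f, hf1, hf2, hf⟩ := hatLe_iff hlt
  have tot : ∀ x y, ¬ hatLe lt x y → hatLe lt y x := by
    intro x y h
    rw [hf] at h ⊢
    rcases trichotomous_of lt (f x) (f y) with h' | h' | h' <;> tauto
  have anti : ∀ x y, hatEq lt x y → f x = f y := by
    rintro x y ⟨h1, h2⟩
    rw [hf] at h1 h2
    rcases h1 with h1 | h1
    · rcases h2 with h2 | h2
      · exact (asymm_of lt h1 h2).elim
      · exact h2.symm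
    · exact h1
  set x := f ν' with hx
  have hle : ∀ y, hatLe lt y ν' → hatLe lt y x := by
    intro y hy
    rcases hf1 ν' with h | h
    · rw [hx, h]; exact hy
    · rw [hx, h]; exact hatLe_inv_right.2 hy
  have orient : ∀ s t, s ∈ C → t ∈ C → hatEq lt (s⁻¹ * t) ν' →
      ∃ p q, p ∈ C ∧ q ∈ C ∧ q = p * x ∧ ((p = s ∧ q = t) ∨ (p = t ∧ q = s)) := by
    intro s t hs ht h
    have h' := anti _ _ h
    rcases hf1 (s⁻¹ * t) with h2 | h2
    · exact ⟨s, t, hs, ht, by rw [hx, ← h', h2]; group, Or.inl ⟨rfl, rfl⟩⟩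
    · exact ⟨t, s, ht, hs, by rw [hx, ← h', h2]; group, Or.inr ⟨rfl, rfl⟩⟩
  have one_le : hatLe lt 1 x := by
    by_contra h
    have h0 := hatLe_norm hlt (tot _ _ h)
    rw [FreeGroup.norm_one] at h0
    have : x = 1 := FreeGroup.norm_eq_zero.1 (by omega)
    rw [this] at h
    apply h
    rw [hf]; exact Or.inr rfl
  have dist : ∀ p q, p ∈ C → q ∈ C → hatLe lt (p⁻¹ * q) x := by
    intro p q hp hq
    by_cases h : p = q
    · subst h; rw [inv_mul_cancel]; exact one_le
    · exact hle _ (hC' hp hq h).2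
  have uniq : ∀ p p', p ∈ C → p' ∈ C → p * x ∈ C → p' * x ∈ C → x ≠ 1 → p' = p := by
    intro p p' hp hp' hq hq' hx1
    by_contra hne
    refine core hlt (x := x) (g := p⁻¹ * p') hx1 (hf2 ν') ?_ (dist _ _ hp hp') ?_ ?_ ?_
    · intro h; exact hne (inv_mul_eq_one.1 h).symm
    · have := dist _ _ hq hp'
      rwa [mul_inv_rev, mul_assoc] at this
    · have := dist _ _ hp hq'
      rwa [← mul_assoc] at this
    · have := dist _ _ hq hq'
      rwa [mul_inv_rev, ← mul_assoc, mul_assoc x⁻¹ p⁻¹ p'] at this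
  have ex : ∃ s t, s ∈ C ∧ t ∈ C ∧ s ≠ t ∧ ¬ hatLe lt (s⁻¹ * t) ν := by
    by_contra hcon
    apply hC
    intro s hs t ht hst
    refine ⟨hst, ?_⟩
    by_contra h
    exact hcon ⟨s, t, hs, ht, hst, h⟩
  obtain ⟨s, t, hs, ht, hst, hnle⟩ := ex
  have hEq : hatEq lt (s⁻¹ * t) ν' := by
    have h1 : hatLe lt (s⁻¹ * t) ν' := (hC' hs ht hst).2
    refine ⟨h1, ?_⟩
    by_contra h2
    exact hsucc.2 (s⁻¹ * t) ⟨⟨tot _ _ hnle, hnle⟩, ⟨h1, h2⟩⟩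
  refine ⟨s, t, hs, ht, hst, hEq, ?_⟩
  intro s' t' hs' ht' hst' hEq'
  obtain ⟨p, q, hp, hq, e, hor⟩ := orient s t hs ht hEq
  obtain ⟨p', q', hp', hq', e', hor'⟩ := orient s' t' hs' ht' hEq'
  have hx1 : x ≠ 1 := by
    intro h
    rw [h, mul_one] at e
    rcases hor with ⟨h1, h2⟩ | ⟨h1, h2⟩
    · exact hst (by rw [← h1, ← h2, e])
    · exact hst (by rw [← h1, ← h2, e])
  have hpp : p' = p := uniq p p' hp hp' (e ▸ hq) (e' ▸ hq') hx1
  have hqq : q' = q := by rw [e, e', hpp]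
  subst hpp hqq
  rcases hor with ⟨rfl, rfl⟩ | ⟨rfl, rfl⟩ <;> rcases hor' with ⟨rfl, rfl⟩ | ⟨rfl, rfl⟩ <;> simp

end FreeGroupLex
end

section
/- Fix a lexicographic order ≼ on the free group F = Fₘ, let ν ∈ F̂ with immediate successor ν⁺, and let H be a complex Hilbert space. Then every positive definite function φ : Σ_ν → L(H) admits a positive definite extension to Σ_{ν⁺}. -/
namespace FreeGroupLex

variable {m : ℕ}

/-- `Σ_ν = ⋃_{ν' ≼ ν} ν'`: the set of elements of `F` whose class in `F̂` is `≼` the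
class of `ν`. -/
def Sigma' (lt : FreeGroup (Fin m) → FreeGroup (Fin m) → Prop)
    (ν : FreeGroup (Fin m)) : Set (FreeGroup (Fin m)) :=
  {x | hatLe lt x ν}

open scoped ComplexOrder in
/-- A function `φ` (with relevant values on a symmetric subset `S` of the free group) is
*positive definite on `S`* if for every finite family `s₁, …, s_k ∈ S` with
`sᵢ⁻¹sⱼ ∈ S` for all `i, j`, the block operator matrix `[φ(sᵢ⁻¹sⱼ)]` is positive
semidefinite. -/
def IsPosDefOn {H : Type*} [NormedAddCommGroup H] [InnerProductSpace ℂ H]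
    (S : Set (FreeGroup (Fin m))) (φ : FreeGroup (Fin m) → H →L[ℂ] H) : Prop :=
  ∀ (k : ℕ) (s : Fin k → FreeGroup (Fin m)), (∀ i, s i ∈ S) →
    (∀ i j, (s i)⁻¹ * s j ∈ S) → ∀ h : Fin k → H,
    0 ≤ ∑ i, ∑ j, (inner ℂ (h i) (φ ((s i)⁻¹ * s j) (h j)) : ℂ)

theorem exists_prefix_decomp {α : Type*} (X : List α) : ∀ Y : List α, ∃ P R Q : List α,
    X = P ++ R ∧ Y = P ++ Q ∧ ∀ a ∈ R.head?, ∀ b ∈ Q.head?, a ≠ b := by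
  classical
  induction X with
  | nil => intro Y; exact ⟨[], [], Y, by simp⟩
  | cons a X ih =>
    intro Y
    cases Y with
    | nil => exact ⟨[], a :: X, [], by simp⟩
    | cons b Y =>
      by_cases h : a = b
      · obtain ⟨P, R, Q, h1, h2, h3⟩ := ih Y
        exact ⟨a :: P, R, Q, by simp [h1], by simp [h2, h], h3⟩
      · exact ⟨[], a :: X, b :: Y, by simp, by simp, by simpa using h⟩

theorem isReduced_invRev {L : List (Fin m × Bool)} (h : FreeGroup.IsReduced L) :
    FreeGroup.IsReduced (FreeGroup.invRev L) := by
  rw [FreeGroup.isReduced_iff_reduce_eq] at h ⊢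
  rw [FreeGroup.reduce_invRev, h]

theorem isReduced_invRev_append {R Q : List (Fin m × Bool)} (hR : FreeGroup.IsReduced R)
    (hQ : FreeGroup.IsReduced Q) (h : ∀ a ∈ R.head?, ∀ b ∈ Q.head?, a ≠ b) :
    FreeGroup.IsReduced (FreeGroup.invRev R ++ Q) := by
  have h1 := isReduced_invRev hR
  unfold FreeGroup.IsReduced at *
  rw [List.isChain_append]
  refine ⟨h1, hQ, ?_⟩
  intro x hx y hy
  have h2 : (FreeGroup.invRev R).getLast? = R.head?.map (fun g : Fin m × Bool => (g.1, !g.2)) := by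
    simp [FreeGroup.invRev]
  rw [h2] at hx
  cases hh : R.head? with
  | none => simp [hh] at hx
  | some a =>
    simp [hh] at hx
    subst hx
    have := h a (by simp [hh]) y hy
    intro h3
    simp only at h3 ⊢
    by_contra h4
    apply this
    ext
    · simp [h3]
    · cases h5 : a.2 <;> cases h6 : y.2 <;> simp_all

theorem isReduced_left {P Q : List (Fin m × Bool)} (h : FreeGroup.IsReduced (P ++ Q)) :
    FreeGroup.IsReduced P := by
  unfold FreeGroup.IsReduced at *
  rw [List.isChain_append] at h
  exact h.1

theorem isReduced_right {P Q : List (Fin m × Bool)} (h : FreeGroup.IsReduced (P ++ Q)) :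
    FreeGroup.IsReduced Q := by
  unfold FreeGroup.IsReduced at *
  rw [List.isChain_append] at h
  exact h.2.1

theorem toWord_mk_of_reduced {L : List (Fin m × Bool)} (h : FreeGroup.IsReduced L) :
    (FreeGroup.mk L).toWord = L := by
  rw [FreeGroup.toWord_mk, h.reduce_eq]

/-- A nonempty reduced word does not share more than half of itself with its inverse. -/
theorem prefix_inv_false {P Q R : List (Fin m × Bool)} (hW : FreeGroup.IsReduced (P ++ Q))
    (h : FreeGroup.invRev (P ++ Q) = P ++ R) (hlen : Q.length ≤ P.length)
    (hpos : 0 < (P ++ Q).length) : False := by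
  set W := P ++ Q with hWdef
  have hWl : W.length = P.length + Q.length := by simp [hWdef]
  have key : ∀ c, (hc : c < P.length) → W[c]'(by omega) =
      ((W[W.length - 1 - c]'(by omega)).1, !(W[W.length - 1 - c]'(by omega)).2) := by
    intro c hc
    have e1 : W[c]? = P[c]? := by rw [hWdef, List.getElem?_append_left hc]
    have e2 : (FreeGroup.invRev W)[c]? = P[c]? := by rw [h, List.getElem?_append_left hc]
    rw [← e1] at e2
    have e3 : (FreeGroup.invRev W)[c]? = some ((W[W.length - 1 - c]'(by omega)).1,
        !(W[W.length - 1 - c]'(by omega)).2) := by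
      unfold FreeGroup.invRev
      rw [List.getElem?_reverse (by simp; omega)]
      simp only [List.length_map, List.getElem?_map]
      rw [List.getElem?_eq_getElem (by omega)]
      rfl
    rw [e3, List.getElem?_eq_getElem (by omega)] at e2
    exact (Option.some.inj e2).symm
  rcases Nat.even_or_odd' W.length with ⟨k, hk | hk⟩
  · have := key (k-1) (by omega)
    have hch := hW
    unfold FreeGroup.IsReduced at hch
    rw [List.isChain_iff_getElem] at hch
    have h2 := hch (k-1) (by omega)
    have e : W.length - 1 - (k-1) = k - 1 + 1 := by omega
    simp only [e] at this
    rw [this] at h2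
    simp at h2
  · have := key k (by omega)
    have e : W.length - 1 - k = k := by omega
    simp only [e] at this
    have := congrArg Prod.snd this
    simp at this

theorem sq_norm_gt (w : FreeGroup (Fin m)) (hw : w ≠ 1) :
    FreeGroup.norm w < FreeGroup.norm (w * w) := by
  obtain ⟨P, R, Q, h1, h2, h3⟩ := exists_prefix_decomp (w⁻¹).toWord w.toWord
  have hRr : FreeGroup.IsReduced R :=
    isReduced_right (P := P) (by rw [← h1]; exact FreeGroup.isReduced_toWord)
  have hW : FreeGroup.IsReduced (P ++ Q) := by rw [← h2]; exact FreeGroup.isReduced_toWord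
  have hred := isReduced_invRev_append hRr (isReduced_right hW) h3
  have e : w * w = FreeGroup.mk (FreeGroup.invRev R ++ Q) := by
    have a1 : w⁻¹ = FreeGroup.mk P * FreeGroup.mk R := by
      rw [FreeGroup.mul_mk, ← h1, FreeGroup.mk_toWord]
    have a2 : w = FreeGroup.mk P * FreeGroup.mk Q := by
      rw [FreeGroup.mul_mk, ← h2, FreeGroup.mk_toWord]
    rw [← FreeGroup.mul_mk, ← FreeGroup.inv_mk]
    calc w * w = (w⁻¹)⁻¹ * w := by simp
      _ = (FreeGroup.mk P * FreeGroup.mk R)⁻¹ * (FreeGroup.mk P * FreeGroup.mk Q) := by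
        rw [← a1, ← a2]
      _ = _ := by group
  have hl : R.length = Q.length := by
    have := congrArg List.length h1
    have := congrArg List.length h2
    simp [FreeGroup.toWord_inv] at *
    omega
  have hn : FreeGroup.norm w = P.length + Q.length := by simp [FreeGroup.norm, h2]
  have hn2 : FreeGroup.norm (w * w) = Q.length + Q.length := by
    rw [e, FreeGroup.norm, toWord_mk_of_reduced hred]; simp [hl]
  by_contra hcon
  refine prefix_inv_false (R := R) hW ?_ (by omega) ?_
  · rw [← h2, ← FreeGroup.toWord_inv, h1]
  · have : FreeGroup.norm w ≠ 0 := by simpa using hw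
    simp; omega

theorem cpl_append_s6 {α : Type*} [DecidableEq α] : ∀ (P P' : List α), P.length = P'.length →
    P ≠ P' → ∃ a b, ∀ Z Z' : List α,
      (P ++ Z)[commonPrefixLen (P ++ Z) (P' ++ Z')]? = some a ∧
      (P' ++ Z')[commonPrefixLen (P ++ Z) (P' ++ Z')]? = some b
  | [], [], _, h => absurd rfl h
  | [], _ :: _, h, _ => by simp at h
  | _ :: _, [], h, _ => by simp at h
  | x :: P, y :: P', hl, hne => by
    by_cases h : x = y
    · subst h
      obtain ⟨a, b, hab⟩ := cpl_append_s6 P P' (by simpa using hl) (by simpa using hne)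
      exact ⟨a, b, fun Z Z' => by simpa [commonPrefixLen] using hab Z Z'⟩
    · exact ⟨x, y, fun Z Z' => by simp [commonPrefixLen, h]⟩

theorem lex_congr {lt : FreeGroup (Fin m) → FreeGroup (Fin m) → Prop} (hlt : IsLexOrder lt)
    {P P' Z Z' Y Y' : List (Fin m × Bool)} (hP : P.length = P'.length) (hne : P ≠ P')
    (hZ : Z.length = Z'.length) (hY : Y.length = Y'.length)
    (r1 : FreeGroup.IsReduced (P ++ Z)) (r2 : FreeGroup.IsReduced (P' ++ Z'))
    (r3 : FreeGroup.IsReduced (P ++ Y)) (r4 : FreeGroup.IsReduced (P' ++ Y'))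
    (h : lt (FreeGroup.mk (P ++ Z)) (FreeGroup.mk (P' ++ Z'))) :
    lt (FreeGroup.mk (P ++ Y)) (FreeGroup.mk (P' ++ Y')) := by
  obtain ⟨a, b, hab⟩ := cpl_append_s6 P P' hP hne
  have aux : ∀ {V V' : List (Fin m × Bool)}, V.length = V'.length →
      FreeGroup.IsReduced (P ++ V) → FreeGroup.IsReduced (P' ++ V') →
      (lt (FreeGroup.mk (P ++ V)) (FreeGroup.mk (P' ++ V')) ↔
        lt (FreeGroup.mk [a]) (FreeGroup.mk [b])) := by
    intro V V' hV s1 s2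
    apply hlt.2.2
    · simp [FreeGroup.norm, s1.reduce_eq, s2.reduce_eq, hP, hV]
    · intro e
      have := congrArg FreeGroup.toWord e
      rw [toWord_mk_of_reduced s1, toWord_mk_of_reduced s2] at this
      exact hne (List.append_inj this hP).1
    · rw [toWord_mk_of_reduced s1, toWord_mk_of_reduced s2]; exact (hab V V').1
    · rw [toWord_mk_of_reduced s1, toWord_mk_of_reduced s2]; exact (hab V V').2
  rw [aux hY r3 r4, ← aux hZ r1 r2]
  exact h

/-- The key combinatorial lemma, asymmetric version. -/
theorem key_aux {lt : FreeGroup (Fin m) → FreeGroup (Fin m) → Prop} (hlt : IsLexOrder lt)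
    (w x y : FreeGroup (Fin m)) (hw : lt w w⁻¹)
    (hy : lt y w ∨ lt y⁻¹ w)
    (hx : FreeGroup.norm x ≤ FreeGroup.norm w)
    (hxw : lt (x⁻¹ * w) w ∨ lt (x⁻¹ * w)⁻¹ w)
    (hyn : FreeGroup.norm y ≤ FreeGroup.norm w)
    (hxwn : FreeGroup.norm (x⁻¹ * w) ≤ FreeGroup.norm w)
    (P R Q P' S Q' : List (Fin m × Bool))
    (h1 : x.toWord = P ++ R) (h2 : w.toWord = P ++ Q)
    (h3 : ∀ a ∈ R.head?, ∀ b ∈ Q.head?, a ≠ b)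
    (h4 : y.toWord = P' ++ S) (h5 : w.toWord = P' ++ Q')
    (hle : P.length ≤ P'.length) :
    lt (x⁻¹ * y) w ∨ lt (x⁻¹ * y)⁻¹ w := by
  have := hlt.1
  obtain ⟨T, hT⟩ : ∃ T, P' = P ++ T := by
    have : P <+: P' := List.prefix_of_prefix_length_le ⟨Q, h2.symm⟩ ⟨Q', h5.symm⟩ hle
    obtain ⟨T, hT⟩ := this
    exact ⟨T, hT.symm⟩
  subst hT
  have hQ : Q = T ++ Q' := by
    rw [h2, List.append_assoc] at h5
    exact List.append_cancel_left h5
  have rX : FreeGroup.IsReduced (P ++ R) := by rw [← h1]; exact FreeGroup.isReduced_toWord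
  have rW : FreeGroup.IsReduced (P ++ Q) := by rw [← h2]; exact FreeGroup.isReduced_toWord
  have eX : x = FreeGroup.mk P * FreeGroup.mk R := by
    rw [FreeGroup.mul_mk, ← h1, FreeGroup.mk_toWord]
  have eW' : w = FreeGroup.mk (P ++ Q) := by rw [← h2, FreeGroup.mk_toWord]
  have eW : w = FreeGroup.mk P * FreeGroup.mk Q := by rw [FreeGroup.mul_mk, ← eW']
  have eY : y = FreeGroup.mk P * FreeGroup.mk (T ++ S) := by
    rw [FreeGroup.mul_mk, ← List.append_assoc, ← h4, FreeGroup.mk_toWord]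
  have exw : x⁻¹ * w = FreeGroup.mk (FreeGroup.invRev R ++ Q) := by
    rw [← FreeGroup.mul_mk, ← FreeGroup.inv_mk, eX, eW]; group
  have exy : x⁻¹ * y = FreeGroup.mk (FreeGroup.invRev R ++ (T ++ S)) := by
    rw [← FreeGroup.mul_mk, ← FreeGroup.inv_mk, eX, eY]; group
  have rxw := isReduced_invRev_append (isReduced_right rX) (isReduced_right rW) h3
  have nW : FreeGroup.norm w = P.length + Q.length := by simp [FreeGroup.norm, h2]
  have nX : FreeGroup.norm x = P.length + R.length := by simp [FreeGroup.norm, h1]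
  have nY : FreeGroup.norm y = P.length + T.length + S.length := by
    simp [FreeGroup.norm, h4, add_assoc]
  have nxw : FreeGroup.norm (x⁻¹ * w) = R.length + Q.length := by
    rw [exw, FreeGroup.norm, toWord_mk_of_reduced rxw]; simp
  have nQ : Q.length = T.length + Q'.length := by simp [hQ]
  have nxy : FreeGroup.norm (x⁻¹ * y) ≤ R.length + T.length + S.length := by
    rw [exy]
    refine FreeGroup.norm_mk_le.trans ?_
    simp; omega
  rcases lt_or_ge (FreeGroup.norm (x⁻¹ * y)) (FreeGroup.norm w) with hlt' | hge
  · exact Or.inl (hlt.2.1 _ _ hlt')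
  have lR : R.length = P.length := by omega
  have lS : S.length = Q'.length := by omega
  have rxy : FreeGroup.IsReduced (FreeGroup.invRev R ++ (T ++ S)) := by
    rw [FreeGroup.isReduced_iff_reduce_eq]
    have hs : List.Sublist (FreeGroup.reduce (FreeGroup.invRev R ++ (T ++ S)))
        (FreeGroup.invRev R ++ (T ++ S)) :=
      FreeGroup.reduce.red.sublist
    apply hs.eq_of_length_le
    have hge' : FreeGroup.norm (x⁻¹ * y) =
        (FreeGroup.reduce (FreeGroup.invRev R ++ (T ++ S))).length := by
      rw [exy, FreeGroup.norm, FreeGroup.toWord_mk]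
    simp only [List.length_append, FreeGroup.invRev_length]
    omega
  by_cases hP0 : P.length = 0
  · have hP : P = [] := List.length_eq_zero_iff.1 hP0
    have hR : R = [] := List.length_eq_zero_iff.1 (by omega)
    have : x = 1 := by rw [eX, hP, hR]; rfl
    simpa [this] using hy
  by_cases hRP : FreeGroup.invRev R = P
  · exfalso
    have : x⁻¹ * w = w := by rw [exw, hRP, eW']
    rw [this] at hxw
    rcases hxw with h | h
    · exact irrefl_of lt w h
    · exact asymm_of lt h hw
  rcases hxw with h | h
  · left
    rw [exy]
    rw [exw] at h
    rw [eW'] at h ⊢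
    exact lex_congr hlt (by simp [lR]) hRP rfl (by simp [lS, nQ]) rxw rW rxy rW h
  · exfalso
    -- split w = C ++ D, |C| = |Q|
    have ei : (x⁻¹ * w)⁻¹ = FreeGroup.mk (FreeGroup.invRev Q ++ R) := by
      rw [exw, FreeGroup.inv_mk, FreeGroup.invRev_append, FreeGroup.invRev_invRev]
    have ri : FreeGroup.IsReduced (FreeGroup.invRev Q ++ R) := by
      have := isReduced_invRev rxw
      rwa [FreeGroup.invRev_append, FreeGroup.invRev_invRev] at this
    have ewi : w⁻¹ = FreeGroup.mk (FreeGroup.invRev Q ++ FreeGroup.invRev P) := by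
      rw [eW', FreeGroup.inv_mk, FreeGroup.invRev_append]
    have rwi : FreeGroup.IsReduced (FreeGroup.invRev Q ++ FreeGroup.invRev P) := by
      have := isReduced_invRev rW
      rwa [FreeGroup.invRev_append] at this
    obtain ⟨C, D, hCD, lC⟩ : ∃ C D, w.toWord = C ++ D ∧ C.length = Q.length := by
      refine ⟨w.toWord.take Q.length, w.toWord.drop Q.length, by simp, ?_⟩
      rw [List.length_take, h2]; simp
    have lD : D.length = P.length := by
      have := congrArg List.length hCD
      rw [h2] at this
      simp at this; omega
    have rCD : FreeGroup.IsReduced (C ++ D) := by rw [← hCD]; exact FreeGroup.isReduced_toWord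
    have eCD : w = FreeGroup.mk (C ++ D) := by rw [← hCD, FreeGroup.mk_toWord]
    by_cases hC : FreeGroup.invRev Q = C
    · refine prefix_inv_false (P := C) (Q := D) (R := FreeGroup.invRev P) rCD ?_ ?_ ?_
      · rw [← hCD, h2, FreeGroup.invRev_append, hC]
      · omega
      · simp; omega
    · rw [ei, eCD] at h
      have := lex_congr hlt (by simp [lC]) hC (by omega) (by simp [lD]) ri rCD rwi rCD h
      rw [← ewi, ← eCD] at this
      exact asymm_of lt this hw

theorem norm_le_of_mem {lt : FreeGroup (Fin m) → FreeGroup (Fin m) → Prop} (hlt : IsLexOrder lt)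
    {w x : FreeGroup (Fin m)} (hx : lt x w ∨ lt x⁻¹ w) :
    FreeGroup.norm x ≤ FreeGroup.norm w := by
  have := hlt.1
  by_contra hcon
  push Not at hcon
  rcases hx with h | h
  · exact asymm_of lt h (hlt.2.1 _ _ hcon)
  · exact asymm_of lt h (hlt.2.1 _ _ (by rwa [FreeGroup.norm_inv_eq]))

/-- The key combinatorial lemma: common neighbours of `1` and `w` are adjacent. -/
theorem key_lemma {lt : FreeGroup (Fin m) → FreeGroup (Fin m) → Prop} (hlt : IsLexOrder lt)
    (w x y : FreeGroup (Fin m)) (hw : lt w w⁻¹)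
    (hx : lt x w ∨ lt x⁻¹ w) (hy : lt y w ∨ lt y⁻¹ w)
    (hxw : lt (x⁻¹ * w) w ∨ lt (x⁻¹ * w)⁻¹ w) (hyw : lt (y⁻¹ * w) w ∨ lt (y⁻¹ * w)⁻¹ w) :
    lt (x⁻¹ * y) w ∨ lt (x⁻¹ * y)⁻¹ w := by
  obtain ⟨P, R, Q, h1, h2, h3⟩ := exists_prefix_decomp x.toWord w.toWord
  obtain ⟨P', S, Q', h4, h5, h6⟩ := exists_prefix_decomp y.toWord w.toWord
  have a := norm_le_of_mem hlt hx
  have b := norm_le_of_mem hlt hy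
  have c := norm_le_of_mem hlt hxw
  have d := norm_le_of_mem hlt hyw
  rcases le_total P.length P'.length with h | h
  · exact key_aux hlt w x y hw hy a hxw b c P R Q P' S Q' h1 h2 h3 h4 h5 h
  · have := key_aux hlt w y x hw hx b hyw a d P' S Q' P R Q h4 h5 h6 h1 h2 h
    have e : (x⁻¹ * y)⁻¹ = y⁻¹ * x := by group
    have e' : x⁻¹ * y = (y⁻¹ * x)⁻¹ := by group
    rw [e, e']; exact this.symm

/-- Description of `Σ_ν` and `Σ_{ν⁺}` by the smaller representative `w` of `ν⁺`. -/
theorem succ_description {lt : FreeGroup (Fin m) → FreeGroup (Fin m) → Prop}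
    (hlt : IsLexOrder lt) (ν ν' : FreeGroup (Fin m))
    (hsucc : hatLt lt ν ν' ∧ ∀ μ : FreeGroup (Fin m), ¬ (hatLt lt ν μ ∧ hatLt lt μ ν')) :
    ∃ w : FreeGroup (Fin m), w ≠ 1 ∧ lt w w⁻¹ ∧
      (∀ x, x ∈ Sigma' lt ν ↔ (lt x w ∨ lt x⁻¹ w)) ∧
      (∀ x, x ∈ Sigma' lt ν' ↔ (x ∈ Sigma' lt ν ∨ x = w ∨ x = w⁻¹)) := by
  classical
  have := hlt.1
  let := linearOrderOfSTO lt
  have elt : ∀ a b : FreeGroup (Fin m), lt a b ↔ a < b := fun a b => Iff.rfl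
  have hle : ∀ a b : FreeGroup (Fin m), hatLe lt a b ↔ min a a⁻¹ ≤ min b b⁻¹ := by
    intro a b
    unfold hatLe
    simp only [elt, ← le_iff_lt_or_eq, le_min_iff, min_le_iff]
  have hlt' : ∀ a b : FreeGroup (Fin m), hatLt lt a b ↔ min a a⁻¹ < min b b⁻¹ := by
    intro a b
    unfold hatLt
    rw [hle, hle, not_le]
    exact ⟨fun h => h.2, fun h => ⟨h.le, h⟩⟩
  obtain ⟨hs1, hs2⟩ := hsucc
  rw [hlt'] at hs1
  have one_le : ∀ a : FreeGroup (Fin m), 1 ≤ a := by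
    intro a
    by_cases ha : a = 1
    · rw [ha]
    · refine le_of_lt ((elt _ _).1 (hlt.2.1 _ _ ?_))
      rw [FreeGroup.norm_one]
      exact Nat.pos_of_ne_zero (by simpa using ha)
  have hmin : min (min ν' ν'⁻¹) (min ν' ν'⁻¹)⁻¹ = min ν' ν'⁻¹ := by
    rcases min_cases ν' ν'⁻¹ with ⟨h, h'⟩ | ⟨h, h'⟩ <;> rw [h]
    · exact h
    · rw [inv_inv]; exact min_eq_left h'.le
  have hcases : min ν' ν'⁻¹ = ν' ∨ min ν' ν'⁻¹ = ν'⁻¹ := min_choice _ _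
  generalize hwdef : min ν' ν'⁻¹ = w at *
  have hw1 : w ≠ 1 := by
    rintro rfl
    exact absurd hs1 (not_lt.2 (one_le _))
  have hSig : ∀ x, x ∈ Sigma' lt ν ↔ (lt x w ∨ lt x⁻¹ w) := by
    intro x
    simp only [Sigma', Set.mem_ofPred_eq, hle, elt, ← min_lt_iff]
    constructor
    · intro h; exact h.trans_lt hs1
    · intro h
      by_contra hcon
      refine hs2 x ⟨?_, ?_⟩
      · rw [hlt']; exact not_le.1 hcon
      · rw [hlt', hwdef]; exact h
  refine ⟨w, hw1, ?_, hSig, ?_⟩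
  · rw [elt]
    refine lt_of_le_of_ne (min_eq_left_iff.1 hmin) ?_
    intro e
    have h0 := sq_norm_gt w hw1
    have : w * w = 1 := by
      nth_rw 1 [e]; simp
    rw [this] at h0
    simp at h0
  · intro x
    rw [hSig]
    simp only [Sigma', Set.mem_ofPred_eq, hle, elt, ← min_lt_iff, hwdef]
    rw [le_iff_lt_or_eq]
    refine or_congr Iff.rfl ?_
    constructor
    · intro h
      rcases min_choice x x⁻¹ with h' | h' <;> rw [h'] at h
      · exact Or.inl h
      · right; rw [← h, inv_inv]
    · rintro (rfl | rfl)
      · exact hmin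
      · rw [inv_inv, min_comm]; exact hmin

section OperatorPart

open scoped ComplexOrder

variable {H : Type*} [NormedAddCommGroup H] [InnerProductSpace ℂ H]

/-- Positivity of a block kernel. -/
def PsdKernel {ι : Type*} [Fintype ι] (K : ι → ι → H →L[ℂ] H) : Prop :=
  ∀ h : ι → H, 0 ≤ ∑ i, ∑ j, (inner ℂ (h i) (K i j (h j)) : ℂ)

theorem PsdKernel.comap {ι κ : Type*} [Fintype ι] [Fintype κ] {K : ι → ι → H →L[ℂ] H}
    (hK : PsdKernel K) (f : κ → ι) : PsdKernel (fun a b => K (f a) (f b)) := by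
  classical
  intro h
  have := hK (fun i => ∑ a with f a = i, h a)
  convert this using 1
  simp only [map_sum, sum_inner, inner_sum]
  have e1 : ∀ g : κ → ℂ, ∑ a, g a = ∑ i, ∑ a with f a = i, g a := fun g =>
    (Finset.sum_fiberwise (Finset.univ : Finset κ) f g).symm
  rw [e1]
  refine Finset.sum_congr rfl fun i _ => ?_
  rw [Finset.sum_congr rfl fun a _ => e1 _, Finset.sum_comm]
  refine Finset.sum_congr rfl fun j _ => ?_
  rw [Finset.sum_comm]
  refine Finset.sum_congr rfl fun a ha => Finset.sum_congr rfl fun b hb => ?_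
  simp only [Finset.mem_filter, Finset.mem_univ, true_and] at ha hb
  rw [ha, hb]

variable [CompleteSpace H]

theorem exists_factor (E : Type*) [NormedAddCommGroup E] [InnerProductSpace ℂ E] [CompleteSpace E]
    (T : E →L[ℂ] E) (hT : T.IsPositive) :
    ∃ S : E →L[ℂ] E, ∀ x y, (inner ℂ (S x) (S y) : ℂ) = inner ℂ x (T y) := by
  obtain ⟨S, hS⟩ := CStarAlgebra.nonneg_iff_eq_star_mul_self.1
    ((ContinuousLinearMap.nonneg_iff_isPositive T).2 hT)
  refine ⟨S, fun x y => ?_⟩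
  rw [hS, mul_apply_eq_comp, ContinuousLinearMap.star_eq_adjoint,
      ContinuousLinearMap.adjoint_inner_right]

theorem PsdKernel.kolmogorov {ι : Type*} [Fintype ι] {K : ι → ι → H →L[ℂ] H}
    (hK : PsdKernel K) : ∃ v : ι → (H →L[ℂ] PiLp 2 (fun _ : ι => H)),
      ∀ i j x y, (inner ℂ (v i x) (v j y) : ℂ) = inner ℂ x (K i j y) := by
  classical
  let E := PiLp 2 (fun _ : ι => H)
  let pr : ι → (E →L[ℂ] H) := fun i => PiLp.proj 2 (fun _ : ι => H) i
  let T : E →L[ℂ] E := ∑ i, ∑ j, (pr i).adjoint ∘L (K i j) ∘L (pr j)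
  have hT : ∀ x y : E, (inner ℂ x (T y) : ℂ) = ∑ i, ∑ j, inner ℂ (x i) (K i j (y j)) := by
    intro x y
    simp only [T, sum_apply, ContinuousLinearMap.comp_apply]
    rw [inner_sum]
    refine Finset.sum_congr rfl fun i _ => ?_
    rw [inner_sum]
    refine Finset.sum_congr rfl fun j _ => ?_
    rw [ContinuousLinearMap.adjoint_inner_right]
    rfl
  have hpos : T.IsPositive := by
    rw [ContinuousLinearMap.isPositive_iff_complex]
    intro x
    have h0 : 0 ≤ (inner ℂ x (T x) : ℂ) := by rw [hT]; exact hK (fun i => x i)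
    have h1 : (inner ℂ (T x) x : ℂ) = inner ℂ x (T x) := by
      rw [← inner_conj_symm]
      exact (Complex.conj_eq_iff_im.2 (Complex.nonneg_iff.1 h0).2.symm)
    rw [h1]
    obtain ⟨a, b⟩ := Complex.nonneg_iff.1 h0
    exact ⟨Complex.ext (by simp) (by simp [b]), a⟩
  obtain ⟨S, hS⟩ := exists_factor E T hpos
  refine ⟨fun i => S ∘L (pr i).adjoint, fun i j x y => ?_⟩
  have hs : ∀ (j : ι) (y : H) (k : ι), ((pr j).adjoint y) k = if k = j then y else 0 := by
    intro j y k
    refine ext_inner_left ℂ fun z => ?_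
    have : (inner ℂ (WithLp.toLp 2 (Pi.single k z) : E) ((pr j).adjoint y) : ℂ)
        = inner ℂ z (((pr j).adjoint y) k) := by
      rw [PiLp.inner_apply]
      rw [Finset.sum_eq_single k]
      · simp
      · intro b _ hb; simp [hb]
      · simp
    rw [← this, ContinuousLinearMap.adjoint_inner_right]
    by_cases hkj : k = j
    · subst hkj; simp [pr]
    · simp [pr, hkj, Ne.symm hkj]
  simp only [ContinuousLinearMap.comp_apply]
  rw [hS, hT]
  simp only [hs]
  rw [Finset.sum_eq_single i]
  · rw [Finset.sum_eq_single j]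
    · simp
    · intro b _ hb; simp [hb]
    · simp
  · intro b _ hb; simp [hb]
  · simp

/-- A partial isometry intertwining two maps with the same Gram form. -/
theorem exists_intertwiner {V E₁ E₂ : Type*} [AddCommGroup V] [Module ℂ V]
    [NormedAddCommGroup E₁] [InnerProductSpace ℂ E₁] [CompleteSpace E₁]
    [NormedAddCommGroup E₂] [InnerProductSpace ℂ E₂] [CompleteSpace E₂]
    (V₁ : V →ₗ[ℂ] E₁) (V₂ : V →ₗ[ℂ] E₂) (h : ∀ a, ‖V₁ a‖ = ‖V₂ a‖) :
    ∃ U : E₂ →L[ℂ] E₁, (∀ b, ‖U b‖ ≤ ‖b‖) ∧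
      ∀ b a, (inner ℂ (U b) (V₁ a) : ℂ) = inner ℂ b (V₂ a) := by
  let M : Submodule ℂ E₂ := V₂.range.topologicalClosure
  have hM : IsClosed (M : Set E₂) := Submodule.isClosed_topologicalClosure _
  have : CompleteSpace M := hM.completeSpace_coe
  let e : V →ₗ[ℂ] M := V₂.codRestrict M (fun a =>
    Submodule.le_topologicalClosure _ (LinearMap.mem_range_self V₂ a))
  have he : ∀ a, ((e a : M) : E₂) = V₂ a := fun a => rfl
  have hd : DenseRange e := by
    intro z
    rw [closure_subtype]
    have hz : (z : E₂) ∈ closure (V₂.range : Set E₂) := z.2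
    convert hz using 2
    ext t
    constructor
    · rintro ⟨_, ⟨a, rfl⟩, rfl⟩; exact ⟨a, rfl⟩
    · rintro ⟨a, rfl⟩; exact ⟨e a, ⟨a, rfl⟩, rfl⟩
  have hn : ∀ a, ‖V₁ a‖ ≤ 1 * ‖e a‖ := by
    intro a; rw [one_mul, h a]; exact le_of_eq rfl
  let U₀ : M →L[ℂ] E₁ := V₁.extendOfNorm e
  have hU₀ : ∀ a, U₀ (e a) = V₁ a := fun a => LinearMap.extendOfNorm_eq hd ⟨1, hn⟩ a
  have hU₀n : ∀ z, ‖U₀ z‖ = ‖z‖ := by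
    intro z
    refine hd.induction (P := fun z => ‖U₀ z‖ = ‖z‖) ?_ (isClosed_eq (by fun_prop) (by fun_prop)) z
    rintro _ ⟨a, rfl⟩
    rw [hU₀, h]; rfl
  let L : M →ₗᵢ[ℂ] E₁ := ⟨U₀.toLinearMap, hU₀n⟩
  refine ⟨U₀ ∘L M.orthogonalProjectionOnto, fun b => ?_, fun b a => ?_⟩
  · rw [ContinuousLinearMap.comp_apply, hU₀n]
    exact M.norm_orthogonalProjectionOnto_apply_le b
  · rw [ContinuousLinearMap.comp_apply, ← hU₀ a]
    have : (inner ℂ (U₀ (M.orthogonalProjectionOnto b)) (U₀ (e a)) : ℂ) =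
      inner ℂ (M.orthogonalProjectionOnto b) (e a) := L.inner_map_map _ _
    rw [this, ← he a]
    exact Submodule.inner_orthogonalProjectionOnto_eq_of_mem_right (e a) b

/-- One-step operator completion. -/
theorem completion {N : Type*} [Fintype N] (K₁ K₂ : Option N → Option N → H →L[ℂ] H)
    (h₁ : PsdKernel K₁) (h₂ : PsdKernel K₂)
    (h12 : ∀ i j, K₁ (some i) (some j) = K₂ (some i) (some j)) :
    ∃ B : H →L[ℂ] H, ∀ K : Option (Option N) → Option (Option N) → H →L[ℂ] H,
      K none none = K₁ none none →
      (∀ i, K none (some (some i)) = K₁ none (some i)) →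
      (∀ i, K (some (some i)) none = K₁ (some i) none) →
      (∀ i j, K (some i) (some j) = K₂ i j) →
      K none (some none) = B →
      K (some none) none = B.adjoint → PsdKernel K := by
  obtain ⟨v, hv⟩ := h₁.kolmogorov
  obtain ⟨u, hu⟩ := h₂.kolmogorov
  let V₁ : (N → H) →ₗ[ℂ] _ := ∑ i, (v (some i)).toLinearMap ∘ₗ LinearMap.proj i
  let V₂ : (N → H) →ₗ[ℂ] _ := ∑ i, (u (some i)).toLinearMap ∘ₗ LinearMap.proj i
  have hV₁ : ∀ a, V₁ a = ∑ i, v (some i) (a i) := by intro a; simp [V₁]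
  have hV₂ : ∀ a, V₂ a = ∑ i, u (some i) (a i) := by intro a; simp [V₂]
  have hin : ∀ a, (inner ℂ (V₁ a) (V₁ a) : ℂ) = inner ℂ (V₂ a) (V₂ a) := by
    intro a
    simp only [hV₁, hV₂, sum_inner, inner_sum, hv, hu, h12]
  obtain ⟨U, hU1, hU2⟩ := exists_intertwiner V₁ V₂ (by
    intro a
    have := hin a
    rw [inner_self_eq_norm_sq_to_K, inner_self_eq_norm_sq_to_K] at this
    have h3 : ‖V₁ a‖ ^ 2 = ‖V₂ a‖ ^ 2 := by exact_mod_cast this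
    exact (sq_eq_sq₀ (norm_nonneg _) (norm_nonneg _)).1 h3)
  refine ⟨(v none).adjoint ∘L U ∘L u none, ?_⟩
  intro K k1 k2 k3 k4 k5 k6 h
  let a := v none (h none)
  let b := u none (h (some none))
  let k : N → H := fun i => h (some (some i))
  have hb1 : ∀ c, (inner ℂ (V₁ c) (U b) : ℂ) = inner ℂ (V₂ c) b := by
    intro c
    rw [← inner_conj_symm, hU2, inner_conj_symm]
  have e5 : (inner ℂ (h none) (K none (some none) (h (some none))) : ℂ) = inner ℂ a (U b) := by
    rw [k5]; simp only [ContinuousLinearMap.comp_apply, ContinuousLinearMap.adjoint_inner_right]; rfl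
  have e6 : (inner ℂ (h (some none)) (K (some none) none (h none)) : ℂ) = inner ℂ (U b) a := by
    rw [k6, ContinuousLinearMap.adjoint_inner_right]
    simp only [ContinuousLinearMap.comp_apply, ContinuousLinearMap.adjoint_inner_left]; rfl
  have total : ∑ i, ∑ j, (inner ℂ (h i) (K i j (h j)) : ℂ) =
      inner ℂ (a + V₁ k + U b) (a + V₁ k + U b) + (inner ℂ b b - inner ℂ (U b) (U b)) := by
    simp only [inner_add_left, inner_add_right, hU2, hb1, hin]
    rw [show (inner ℂ a a : ℂ) = inner ℂ (h none) (K none none (h none)) by rw [hv, k1],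
      show (inner ℂ b b : ℂ) = inner ℂ (h (some none)) (K (some none) (some none) (h (some none)))
        by rw [hu, k4],
      show (inner ℂ a (V₁ k) : ℂ) = ∑ i, inner ℂ (h none) (K none (some (some i)) (k i)) by
        simp only [hV₁, inner_sum, a, hv, k2],
      show (inner ℂ (V₁ k) a : ℂ) = ∑ i, inner ℂ (k i) (K (some (some i)) none (h none)) by
        simp only [hV₁, sum_inner, a, hv, k3],
      show (inner ℂ b (V₂ k) : ℂ) =
        ∑ i, inner ℂ (h (some none)) (K (some none) (some (some i)) (k i)) by
        simp only [hV₂, inner_sum, b, hu, k4],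
      show (inner ℂ (V₂ k) b : ℂ) =
        ∑ i, inner ℂ (k i) (K (some (some i)) (some none) (h (some none))) by
        simp only [hV₂, sum_inner, b, hu, k4],
      show (inner ℂ (V₂ k) (V₂ k) : ℂ) =
        ∑ i, ∑ j, inner ℂ (k i) (K (some (some i)) (some (some j)) (k j)) by
        rw [Finset.sum_comm]
        simp only [hV₂, sum_inner, inner_sum, hu, k4],
      ← e5, ← e6]
    simp only [Fintype.sum_option, Finset.sum_add_distrib, k]
    ring
  rw [total]
  refine add_nonneg ?_ ?_
  · rw [inner_self_eq_norm_sq_to_K, ← RCLike.ofReal_pow]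
    exact RCLike.ofReal_nonneg.2 (sq_nonneg _)
  · rw [inner_self_eq_norm_sq_to_K, inner_self_eq_norm_sq_to_K]
    have : ‖U b‖ ^ 2 ≤ ‖b‖ ^ 2 := by gcongr; exact hU1 b
    rw [sub_nonneg]
    exact_mod_cast this

end OperatorPart

theorem IsPosDefOn.psd {H : Type*} [NormedAddCommGroup H] [InnerProductSpace ℂ H]
    {S : Set (FreeGroup (Fin m))} {φ : FreeGroup (Fin m) → H →L[ℂ] H} (hφ : IsPosDefOn S φ)
    {ι : Type*} [Fintype ι] (s : ι → FreeGroup (Fin m)) (hs : ∀ i j, (s i)⁻¹ * s j ∈ S) :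
    PsdKernel (fun i j => φ ((s i)⁻¹ * s j)) := by
  rcases isEmpty_or_nonempty ι with hι | ⟨⟨i0⟩⟩
  · intro h; simp
  intro h
  let e := (Fintype.equivFin ι).symm
  have := hφ (Fintype.card ι) (fun a => (s i0)⁻¹ * s (e a)) (fun a => hs _ _)
    (fun a b => by
      have e1 : ((s i0)⁻¹ * s (e a))⁻¹ * ((s i0)⁻¹ * s (e b)) = (s (e a))⁻¹ * s (e b) := by group
      rw [e1]; exact hs _ _) (fun a => h (e a))
  have e1 : ∀ a b, ((s i0)⁻¹ * s (e a))⁻¹ * ((s i0)⁻¹ * s (e b)) = (s (e a))⁻¹ * s (e b) := by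
    intro a b; group
  simp only [e1] at this
  rw [← e.sum_comp (fun i => ∑ j, (inner ℂ (h i) (φ ((s i)⁻¹ * s j) (h j)) : ℂ))]
  simp only [← e.sum_comp (fun j => (inner ℂ (h _) (φ ((s _)⁻¹ * s j) (h j)) : ℂ))]
  exact this

/-- Every positive definite `L(H)`-valued function on `Σ_ν` admits a
positive definite extension to `Σ_{ν⁺}`, where `ν⁺` is the immediate successor of `ν`
in `F̂`. -/
theorem posDef_extension_succ {m : ℕ}
    {H : Type*} [NormedAddCommGroup H] [InnerProductSpace ℂ H] [CompleteSpace H]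
    (lt : FreeGroup (Fin m) → FreeGroup (Fin m) → Prop) (hlt : IsLexOrder lt)
    (ν ν' : FreeGroup (Fin m))
    (hsucc : hatLt lt ν ν' ∧ ∀ μ : FreeGroup (Fin m), ¬ (hatLt lt ν μ ∧ hatLt lt μ ν'))
    (φ : FreeGroup (Fin m) → H →L[ℂ] H) (hφ : IsPosDefOn (Sigma' lt ν) φ) :
    ∃ Φ : FreeGroup (Fin m) → H →L[ℂ] H,
      IsPosDefOn (Sigma' lt ν') Φ ∧ Set.EqOn Φ φ (Sigma' lt ν) := by
  classical
  obtain ⟨w, hw1, hww, hSig, hSig'⟩ := succ_description hlt ν ν' hsucc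
  have hSlt := hlt.1
  -- basic properties of the sets
  have hinv : ∀ x, x ∈ Sigma' lt ν → x⁻¹ ∈ Sigma' lt ν := by
    intro x hx
    rw [hSig] at hx ⊢
    rw [inv_inv]; exact hx.symm
  have hinv' : ∀ x y : FreeGroup (Fin m), x⁻¹ * y ∈ Sigma' lt ν → y⁻¹ * x ∈ Sigma' lt ν := by
    intro x y h
    have := hinv _ h
    rwa [mul_inv_rev, inv_inv] at this
  have hone : (1 : FreeGroup (Fin m)) ∈ Sigma' lt ν := by
    rw [hSig]
    left
    apply hlt.2.1
    rw [FreeGroup.norm_one]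
    exact Nat.pos_of_ne_zero (by simpa using hw1)
  have hwn : w ∉ Sigma' lt ν := by
    rw [hSig]
    rintro (h | h)
    · exact irrefl_of lt w h
    · exact asymm_of lt h hww
  have hwin : w⁻¹ ∉ Sigma' lt ν := fun h => hwn (by simpa using hinv _ h)
  have hwne : w⁻¹ ≠ w := by
    intro h
    rw [h] at hww
    exact irrefl_of lt w hww
  have hsq : w * w ∉ Sigma' lt ν' := by
    have h0 := sq_norm_gt w hw1
    rw [hSig', hSig]
    rintro (h | h | h)
    · exact absurd (norm_le_of_mem hlt h) (not_le.2 h0)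
    · rw [h] at h0; exact lt_irrefl _ h0
    · rw [h, FreeGroup.norm_inv_eq] at h0; exact lt_irrefl _ h0
  -- the common neighbours
  let N : Set (FreeGroup (Fin m)) := {x | x ∈ Sigma' lt ν ∧ x⁻¹ * w ∈ Sigma' lt ν}
  have hNfin : N.Finite := by
    have hf : {l : List (Fin m × Bool) | l.length ≤ FreeGroup.norm w}.Finite :=
      List.finite_length_le _ _
    refine (hf.preimage (FreeGroup.toWord_injective.injOn)).subset ?_
    intro x hx
    exact norm_le_of_mem hlt ((hSig x).1 hx.1)
  have : Fintype N := hNfin.fintype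
  have hNN : ∀ x y : N, (x : FreeGroup (Fin m))⁻¹ * y ∈ Sigma' lt ν := by
    rintro ⟨x, hx1, hx2⟩ ⟨y, hy1, hy2⟩
    rw [hSig] at hx1 hx2 hy1 hy2 ⊢
    exact key_lemma hlt w x y hww hx1 hy1 hx2 hy2
  let s₁ : Option N → FreeGroup (Fin m) := fun o => o.elim 1 (fun x => x)
  let s₂ : Option N → FreeGroup (Fin m) := fun o => o.elim w (fun x => x)
  have p₁ := hφ.psd s₁ (by
    rintro (_ | x) (_ | y)
    · simpa [s₁] using hone
    · simpa [s₁] using y.2.1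
    · simpa [s₁] using hinv _ x.2.1
    · exact hNN x y)
  have p₂ := hφ.psd s₂ (by
    rintro (_ | x) (_ | y)
    · simpa [s₂] using hone
    · exact hinv' _ _ y.2.2
    · exact x.2.2
    · exact hNN x y)
  obtain ⟨B, hB⟩ := completion _ _ p₁ p₂ (fun i j => rfl)
  let Φ : FreeGroup (Fin m) → H →L[ℂ] H := fun x =>
    if x ∈ Sigma' lt ν then φ x else if x = w then B else B.adjoint
  have hΦ : ∀ x ∈ Sigma' lt ν, Φ x = φ x := fun x hx => by simp only [Φ, if_pos hx]
  have hΦw : Φ w = B := by simp only [Φ, if_neg hwn, if_true]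
  have hΦwi : Φ w⁻¹ = B.adjoint := by simp only [Φ, if_neg hwin, if_neg hwne]
  refine ⟨Φ, ?_, hΦ⟩
  let t : Option (Option N) → FreeGroup (Fin m) := fun o => o.elim 1 s₂
  have hpsd : PsdKernel (fun i j => Φ ((t i)⁻¹ * t j)) := by
    apply hB
    · simp only [t, s₁, Option.elim]; exact hΦ _ (by simpa using hone)
    · intro i
      simp only [t, s₁, s₂, Option.elim]; exact hΦ _ (by simpa using i.2.1)
    · intro i
      simp only [t, s₁, s₂, Option.elim]; exact hΦ _ (by simpa using hinv _ i.2.1)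
    · rintro (_ | x) (_ | y)
      · simp only [t, s₂, Option.elim]; exact hΦ _ (by simpa using hone)
      · simp only [t, s₂, Option.elim]; exact hΦ _ (hinv' _ _ y.2.2)
      · simp only [t, s₂, Option.elim]; exact hΦ _ x.2.2
      · simp only [t, s₂, Option.elim]; exact hΦ _ (hNN x y)
    · simp only [t, s₂, Option.elim, inv_one, one_mul]; exact hΦw
    · simp only [t, s₂, Option.elim, mul_one]; exact hΦwi
  intro k s hs hss
  change PsdKernel (fun i j => Φ ((s i)⁻¹ * s j))
  by_cases hall : ∀ i j, (s i)⁻¹ * s j ∈ Sigma' lt ν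
  · have e : (fun i j => Φ ((s i)⁻¹ * s j)) = fun i j => φ ((s i)⁻¹ * s j) := by
      funext i j; exact hΦ _ (hall i j)
    rw [e]
    exact hφ.psd s hall
  · obtain ⟨i0, j0, hij⟩ : ∃ i0 j0, (s i0)⁻¹ * s j0 = w := by
      push Not at hall
      obtain ⟨i, j, hij⟩ := hall
      rcases (hSig' _).1 (hss i j) with h | h | h
      · exact absurd h hij
      · exact ⟨i, j, h⟩
      · refine ⟨j, i, ?_⟩
        rw [← inv_inv w, ← h]; group
    have hf : ∀ i, ∃ o, t o = (s i0)⁻¹ * s i := by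
      intro i
      set x := (s i0)⁻¹ * s i with hx
      have hxw : x⁻¹ * w = (s i)⁻¹ * s j0 := by rw [hx, ← hij]; group
      have m1 : x ∈ Sigma' lt ν' := hss i0 i
      have m2 : x⁻¹ * w ∈ Sigma' lt ν' := by rw [hxw]; exact hss i j0
      rcases (hSig' _).1 m1 with h | h | h
      · rcases (hSig' _).1 m2 with h' | h' | h'
        · exact ⟨some (some ⟨x, h, h'⟩), rfl⟩
        · refine ⟨none, ?_⟩
          have : x⁻¹ = 1 := by simpa using h'
          exact (inv_eq_one.1 this).symm
        · exfalso
          apply hsq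
          have : x = w * w := by
            have h2 : x⁻¹ = w⁻¹ * w⁻¹ := eq_mul_inv_of_mul_eq h'
            rw [← inv_inv x, h2, mul_inv_rev, inv_inv]
          rw [← this]; exact m1
      · exact ⟨some none, h.symm⟩
      · exfalso
        apply hsq
        rw [h, inv_inv] at m2
        exact m2
    choose f hf using hf
    have := hpsd.comap f
    have e : (fun i j => Φ ((t (f i))⁻¹ * t (f j))) = fun i j => Φ ((s i)⁻¹ * s j) := by
      funext i j
      rw [hf, hf]
      congr 1
      group
    rw [e] at this
    exact this

end FreeGroupLex
end
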